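/- Let A be an improper matrix in M_n whose largest improper column index is i and suppose 1 < i ≤ dim(A), csum_i(A) = 1, rsum_i(A) = 0 and min_i(A) < min_{i−1}(A). Let Φ(A) be the matrix obtained from A by setting the entry in row min_i(A) of column i−1 to 1 and then deleting column i and row i. Then Φ(A) is an improper matrix in M_n, its largest improper column index is i−1, dim(Φ(A)) = dim(A) − 1, and rsum_1(Φ(A)) = rsum_1(A). -/

import Mathlib

open Polynomial

/-- A finite square matrix of natural numbers, of arbitrary dimension. -/
def SqMat : Type := Σ d : ℕ, Matrix (Fin d) (Fin d) ℕ

namespace SqMat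

/-- The number of rows (= number of columns) of the matrix. -/
def dim (A : SqMat) : ℕ := A.1

/-- The entry in row `r`, column `c` (0-indexed), and `0` out of range. -/
def ent (A : SqMat) (r c : ℕ) : ℕ :=
  if h : r < A.1 ∧ c < A.1 then A.2 ⟨r, h.1⟩ ⟨c, h.2⟩ else 0

/-- The sum of the entries of row `i` (0-indexed). -/
def rsum (A : SqMat) (i : ℕ) : ℕ := ∑ j ∈ Finset.range A.1, A.ent i j

/-- The sum of the entries of column `j` (0-indexed). -/
def csum (A : SqMat) (j : ℕ) : ℕ := ∑ i ∈ Finset.range A.1, A.ent i j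

/-- The sum of all entries of the matrix. -/
def total (A : SqMat) : ℕ := ∑ i ∈ Finset.range A.1, A.rsum i

/-- The least row index (0-indexed) at which column `j` has a nonzero entry. -/
noncomputable def colMin (A : SqMat) (j : ℕ) : ℕ := sInf {i : ℕ | A.ent i j ≠ 0}

/-- The matrix is upper triangular. -/
def UpperTri (A : SqMat) : Prop := ∀ r c : ℕ, c < r → A.ent r c = 0

/-- All entries are `0` or `1`. -/
def ZeroOne (A : SqMat) : Prop := ∀ r c : ℕ, A.ent r c ≤ 1

/-- Every column contains at least one nonzero entry. -/
def ColsNonzero (A : SqMat) : Prop := ∀ j < A.1, 0 < A.csum j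

/-- Every row contains at least one nonzero entry. -/
def RowsNonzero (A : SqMat) : Prop := ∀ i < A.1, 0 < A.rsum i

/-- Membership in `M_n`: upper triangular `(0,1)`-matrices with entries summing
to `n` in which every column contains at least one nonzero entry. -/
def MemM (n : ℕ) (A : SqMat) : Prop :=
  A.UpperTri ∧ A.ZeroOne ∧ A.total = n ∧ A.ColsNonzero

/-- Column `j` (0-indexed; so `j` corresponds to the 1-indexed column `j+1` of the paper)
is improper: either its column sum is at least `2`, or `j ≥ 1`, its column sum is `1`,
its row sum is `0`, and `min_j(A) < min_{j-1}(A)`. -/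
def ImproperCol (A : SqMat) (j : ℕ) : Prop :=
  2 ≤ A.csum j ∨
    (1 ≤ j ∧ A.csum j = 1 ∧ A.rsum j = 0 ∧ A.colMin j < A.colMin (j - 1))

/-- The matrix is proper: no column is improper. -/
def Proper (A : SqMat) : Prop := ∀ j < A.1, ¬ A.ImproperCol j

/-- Membership in `PM_n`: proper matrices of `M_n`. -/
def MemPM (n : ℕ) (A : SqMat) : Prop := MemM n A ∧ A.Proper

/-- Membership in `I_n`: upper triangular matrices with non-negative integer entries
summing to `n` in which every row and every column contains at least one nonzero entry. -/
def MemI (n : ℕ) (A : SqMat) : Prop :=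
  A.UpperTri ∧ A.total = n ∧ A.RowsNonzero ∧ A.ColsNonzero

end SqMat

namespace SqMat

/-- The matrix obtained from `A` (for Case (2) of the involution, at 0-indexed column `i`):
replace the entry in row `colMin A i` of column `i - 1` by `1`, then delete column `i` and
row `i`.  (Deleted indices are skipped by mapping an index `r ≥ i` of the new matrix to the
index `r + 1` of `A`.) -/
noncomputable def removePhi (A : SqMat) (i : ℕ) : SqMat :=
  ⟨A.1 - 1, Matrix.of fun r c : Fin (A.1 - 1) =>
    (fun r' c' => if r' = A.colMin i ∧ c' = i - 1 then 1 else A.ent r' c')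
      (if (r : ℕ) < i then (r : ℕ) else (r : ℕ) + 1)
      (if (c : ℕ) < i then (c : ℕ) else (c : ℕ) + 1)⟩

end SqMat

namespace SqMat

/-- The order embedding of `ℕ` into `ℕ` whose range omits exactly `i`. -/
def skip (i k : ℕ) : ℕ := if k < i then k else k + 1

theorem sum_range_skip_add (f : ℕ → ℕ) {i D : ℕ} (h : i ≤ D) :
    ∑ k ∈ Finset.range D, f (skip i k) + f i = ∑ k ∈ Finset.range (D + 1), f k := by
  induction D, h using Nat.le_induction with
  | base =>
    rw [Finset.sum_range_succ]
    congr 1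
    refine Finset.sum_congr rfl fun k hk => ?_
    simp [skip, Finset.mem_range.mp hk]
  | succ D h ih =>
    rw [Finset.sum_range_succ, Finset.sum_range_succ _ (D + 1), ← ih]
    simp only [skip, if_neg (not_lt.mpr h)]
    ring

theorem ent_of_dim_le_row (A : SqMat) {r c : ℕ} (h : A.1 ≤ r) : A.ent r c = 0 := by
  simp [ent, not_lt.mpr h]

theorem ent_of_dim_le_col (A : SqMat) {r c : ℕ} (h : A.1 ≤ c) : A.ent r c = 0 := by
  simp [ent, not_lt.mpr h]

theorem exists_ent_ne_zero {A : SqMat} {c : ℕ} (h : 0 < A.csum c) : ∃ r, A.ent r c ≠ 0 := by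
  obtain ⟨r, -, hr⟩ := Finset.exists_ne_zero_of_sum_ne_zero h.ne'
  exact ⟨r, hr⟩

theorem ent_colMin_ne_zero {A : SqMat} {c : ℕ} (h : 0 < A.csum c) :
    A.ent (A.colMin c) c ≠ 0 :=
  Nat.sInf_mem (s := {r | A.ent r c ≠ 0}) (exists_ent_ne_zero h)

theorem colMin_le {A : SqMat} {r c : ℕ} (h : A.ent r c ≠ 0) : A.colMin c ≤ r :=
  Nat.sInf_le h

theorem ent_of_lt_colMin {A : SqMat} {r c : ℕ} (h : r < A.colMin c) : A.ent r c = 0 := by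
  by_contra hne
  exact absurd (colMin_le hne) (not_le.mpr h)

theorem ent_of_rsum_eq_zero {A : SqMat} {r : ℕ} (h : A.rsum r = 0) (c : ℕ) :
    A.ent r c = 0 := by
  by_cases hc : c < A.1
  · exact Finset.sum_eq_zero_iff.mp h c (Finset.mem_range.mpr hc)
  · exact A.ent_of_dim_le_col (not_lt.mp hc)

theorem ent_of_csum_eq_one {A : SqMat} {c : ℕ} (h : A.csum c = 1) (r : ℕ) :
    A.ent r c = if r = A.colMin c then 1 else 0 := by
  have hm := ent_colMin_ne_zero (A := A) (c := c) (by omega)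
  have hmd : A.colMin c < A.1 := by
    by_contra hlt
    exact hm (A.ent_of_dim_le_row (not_lt.mp hlt))
  have hsum := Finset.add_sum_erase _ (fun r => A.ent r c) (Finset.mem_range.mpr hmd)
  rw [show ∑ r ∈ Finset.range A.1, A.ent r c = 1 from h] at hsum
  have hrest : ∑ r ∈ (Finset.range A.1).erase (A.colMin c), A.ent r c = 0 := by omega
  split_ifs with hr
  · subst hr; omega
  · by_cases hrd : r < A.1
    · exact Finset.sum_eq_zero_iff.mp hrest r
        (Finset.mem_erase.mpr ⟨hr, Finset.mem_range.mpr hrd⟩)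
    · exact A.ent_of_dim_le_row (not_lt.mp hrd)

theorem ent_removePhi {A : SqMat} {i : ℕ} (hi : i < A.1) (hi1 : 1 ≤ i)
    (hm : A.colMin i < i) (r c : ℕ) :
    (A.removePhi i).ent r c =
      if r = A.colMin i ∧ c = i - 1 then 1 else A.ent (skip i r) (skip i c) := by
  by_cases h : r < A.1 - 1 ∧ c < A.1 - 1
  · have h1 : (skip i r = A.colMin i ∧ skip i c = i - 1) ↔ (r = A.colMin i ∧ c = i - 1) := by
      unfold skip
      split_ifs <;> omega
    have h2 : (A.removePhi i).ent r c =
        if skip i r = A.colMin i ∧ skip i c = i - 1 then 1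
        else A.ent (skip i r) (skip i c) := dif_pos h
    rw [h2]
    simp only [h1]
  · rw [if_neg (by omega), show (A.removePhi i).ent r c = 0 from dif_neg h]
    rcases not_and_or.mp h with h | h
    · exact (A.ent_of_dim_le_row (by unfold skip; split_ifs <;> omega)).symm
    · exact (A.ent_of_dim_le_col (by unfold skip; split_ifs <;> omega)).symm

section

variable {A : SqMat} {i : ℕ}

theorem rsum_removePhi (hi1 : 1 ≤ i) (hi : i < A.1) (hm : A.colMin i < i)
    (hcs : A.csum i = 1) (hmin : A.colMin i < A.colMin (i - 1)) (r : ℕ) :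
    (A.removePhi i).rsum r = A.rsum (skip i r) := by
  obtain ⟨D, hD⟩ : ∃ D, A.1 = D + 1 := ⟨A.1 - 1, by omega⟩
  have hB : (A.removePhi i).1 = D := by
    change A.1 - 1 = D
    omega
  have hskip : skip i r = A.colMin i ↔ r = A.colMin i := by
    unfold skip
    split_ifs <;> omega
  have hent : ∀ c, (A.removePhi i).ent r c = A.ent (skip i r) (skip i c) +
      if c = i - 1 then (if r = A.colMin i then 1 else 0) else 0 := by
    intro c
    rw [ent_removePhi hi hi1 hm]
    by_cases hr : r = A.colMin i <;> by_cases hc : c = i - 1 <;> simp only [hr, hc] <;> simp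
    have h1 : skip i (A.colMin i) = A.colMin i := if_pos hm
    have h2 : skip i (i - 1) = i - 1 := if_pos (by omega)
    rw [h1, h2, ent_of_lt_colMin hmin]
  rw [rsum, rsum, hB, hD, ← sum_range_skip_add _ (show i ≤ D by omega),
    ent_of_csum_eq_one hcs, Finset.sum_congr rfl fun c _ => hent c, Finset.sum_add_distrib,
    Finset.sum_ite_eq', if_pos (Finset.mem_range.mpr (by omega))]
  simp only [hskip]

theorem csum_removePhi (hi1 : 1 ≤ i) (hi : i < A.1) (hm : A.colMin i < i)
    (hrs : A.rsum i = 0) (hmin : A.colMin i < A.colMin (i - 1)) (c : ℕ) :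
    (A.removePhi i).csum c = A.csum (skip i c) + if c = i - 1 then 1 else 0 := by
  obtain ⟨D, hD⟩ : ∃ D, A.1 = D + 1 := ⟨A.1 - 1, by omega⟩
  have hB : (A.removePhi i).1 = D := by
    change A.1 - 1 = D
    omega
  have hent : ∀ r, (A.removePhi i).ent r c = A.ent (skip i r) (skip i c) +
      if r = A.colMin i then (if c = i - 1 then 1 else 0) else 0 := by
    intro r
    rw [ent_removePhi hi hi1 hm]
    by_cases hr : r = A.colMin i <;> by_cases hc : c = i - 1 <;> simp only [hr, hc] <;> simp
    have h1 : skip i (A.colMin i) = A.colMin i := if_pos hm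
    have h2 : skip i (i - 1) = i - 1 := if_pos (by omega)
    rw [h1, h2, ent_of_lt_colMin hmin]
  rw [csum, csum, hB, hD,
    ← sum_range_skip_add (fun r => A.ent r (skip i c)) (show i ≤ D by omega),
    ent_of_rsum_eq_zero hrs, Finset.sum_congr rfl fun r _ => hent r, Finset.sum_add_distrib,
    Finset.sum_ite_eq', if_pos (Finset.mem_range.mpr (by omega)), add_zero]

theorem colMin_removePhi (hi1 : 1 ≤ i) (hi : i < A.1) (hm : A.colMin i < i)
    (hrs : A.rsum i = 0) {c : ℕ} (hc : c ≠ i - 1) (hpos : 0 < A.csum (skip i c)) :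
    A.colMin (skip i c) = skip i ((A.removePhi i).colMin c) := by
  have hent : ∀ r, (A.removePhi i).ent r c = A.ent (skip i r) (skip i c) := fun r => by
    rw [ent_removePhi hi hi1 hm, if_neg (by tauto)]
  have hne := ent_colMin_ne_zero hpos
  obtain ⟨r, hr⟩ : ∃ r, skip i r = A.colMin (skip i c) := by
    have : A.colMin (skip i c) ≠ i := fun h => hne (by rw [h, ent_of_rsum_eq_zero hrs])
    by_cases hlt : A.colMin (skip i c) < i
    · exact ⟨_, if_pos hlt⟩
    · exact ⟨A.colMin (skip i c) - 1, by unfold skip at *; split_ifs at * <;> omega⟩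
  have hBr : (A.removePhi i).ent r c ≠ 0 := by rwa [hent, hr]
  have hle := colMin_le hBr
  have hmem : (A.removePhi i).ent ((A.removePhi i).colMin c) c ≠ 0 :=
    Nat.sInf_mem (s := {r | (A.removePhi i).ent r c ≠ 0}) ⟨r, hBr⟩
  rw [hent] at hmem
  refine le_antisymm (colMin_le hmem) ?_
  rw [← hr]
  unfold skip
  split_ifs <;> omega

end

end SqMat

open SqMat in
/-- Let `A ∈ M_n` be improper with largest improper column index `i`
(0-indexed; the paper's 1-indexed column is `i+1`) and suppose `1 ≤ i < dim A` (the
paper's `1 < i ≤ dim A`), `csum_i(A) = 1`, `rsum_i(A) = 0` and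
`min_i(A) < min_{i-1}(A)`.  Then the matrix `Φ(A) = removePhi A i` is an improper matrix
in `M_n`, its largest improper column index is `i-1`, `dim (Φ A) = dim A - 1`, and the
first-row sums of `Φ(A)` and `A` agree. -/
theorem removePhi_spec (n : ℕ) (hn : 0 < n) (A : SqMat) (hA : SqMat.MemM n A)
    (i : ℕ) (hi1 : 1 ≤ i) (hi : i < A.dim) (himp : A.ImproperCol i)
    (hmax : ∀ j : ℕ, i < j → j < A.dim → ¬ A.ImproperCol j)
    (hcs : A.csum i = 1) (hrs : A.rsum i = 0) (hmin : A.colMin i < A.colMin (i - 1)) :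
    SqMat.MemM n (A.removePhi i) ∧
    (∃ j < (A.removePhi i).dim, (A.removePhi i).ImproperCol j) ∧
    (A.removePhi i).ImproperCol (i - 1) ∧
    (∀ j : ℕ, i - 1 < j → j < (A.removePhi i).dim → ¬ (A.removePhi i).ImproperCol j) ∧
    (A.removePhi i).dim = A.dim - 1 ∧
    (A.removePhi i).rsum 0 = A.rsum 0 := by
  obtain ⟨hU, hZ, hT, hC⟩ := hA
  change i < A.1 at hi
  have hm : A.colMin i < i := by
    have h1 := ent_colMin_ne_zero (hC (i - 1) (by omega))
    have h2 : A.colMin (i - 1) ≤ i - 1 := by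
      by_contra h
      exact h1 (hU _ _ (by omega))
    omega
  have hR := rsum_removePhi hi1 hi hm hcs hmin
  have hS := csum_removePhi hi1 hi hm hrs hmin
  have hE := ent_removePhi hi hi1 hm
  have hdim : (A.removePhi i).1 = A.1 - 1 := rfl
  have hlast : (A.removePhi i).ImproperCol (i - 1) := by
    left
    have hpos := hC (i - 1) (by omega)
    rw [hS, if_pos rfl, show skip i (i - 1) = i - 1 from if_pos (by omega)]
    omega
  refine ⟨⟨?_, ?_, ?_, ?_⟩, ⟨i - 1, ?_, hlast⟩, hlast, ?_, rfl, ?_⟩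
  · intro r c hrc
    rw [hE, if_neg (by omega)]
    exact hU _ _ (by unfold skip; split_ifs <;> omega)
  · intro r c
    rw [hE]
    split_ifs
    · exact le_rfl
    · exact hZ _ _
  · rw [← hT, total, total, hdim, Finset.sum_congr rfl fun r _ => hR r]
    have hsum := sum_range_skip_add A.rsum (show i ≤ A.1 - 1 by omega)
    rwa [hrs, add_zero, Nat.sub_add_cancel (by omega)] at hsum
  · intro c hc
    rw [hdim] at hc
    rw [hS]
    exact Nat.add_pos_left (hC _ (by unfold skip; split_ifs <;> omega)) _
  · change i - 1 < A.1 - 1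
    omega
  · intro j hij hj hB
    change j < A.1 - 1 at hj
    have hskip : skip i j = j + 1 := if_neg (by omega)
    have hpos : 0 < A.csum (skip i j) := hC _ (by omega)
    refine hmax (j + 1) (by omega) (show j + 1 < A.1 by omega) ?_
    have hSj := hS j
    have hRj := hR j
    rw [if_neg (by omega), add_zero, hskip] at hSj
    rw [hskip] at hRj
    rcases hB with hB | ⟨-, h1, h2, h3⟩
    · exact Or.inl (hSj ▸ hB)
    · refine Or.inr ⟨by omega, hSj ▸ h1, hRj ▸ h2, ?_⟩
      have hj1 := colMin_removePhi hi1 hi hm hrs (by omega) hpos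
      rw [hskip] at hj1
      rw [hj1, Nat.add_sub_cancel]
      by_cases hji : j = i
      · subst hji
        have hle : (A.removePhi j).colMin (j - 1) ≤ A.colMin j :=
          colMin_le (by rw [hE]; simp)
        unfold skip
        split_ifs <;> omega
      · have hskip' : skip i (j - 1) = j := by
          unfold skip
          split_ifs <;> omega
        have hj2 := colMin_removePhi (c := j - 1) hi1 hi hm hrs (by omega)
          (hC _ (by omega))
        rw [hskip'] at hj2
        rw [hj2]
        unfold skip
        split_ifs <;> omega
  · rw [hR, show skip i 0 = 0 from if_pos (by omega)]
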